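/- arXiv:2307.03991 — 3 statements merged into one kernel-verified Lean document; each statement's English description precedes it below -/
import Mathlib

section
/- For all integers m, n ≥ 1, every permutation σ of {1,…,m} and every permutation ρ of {1,…,n}, define w : {1,…,m+n} → {1,…,m+n} by w(i) = σ(i) for 1 ≤ i ≤ m and w(i) = m + ρ(i−m) for m < i ≤ m+n. Then Σ_{τ ∈ Sh(m,n)} χ_{m+n}(x_{w(τ⁻¹(1))}, …, x_{w(τ⁻¹(m+n))}) = χ_m(x_{σ(1)}, …, x_{σ(m)}) · χ_n(x_{m+ρ(1)}, …, x_{m+ρ(n)}) in K. (This identity expresses that the assignment F_σ ↦ χ_m(x_{σ(1)},…,x_{σ(m)}) on the F-basis is multiplicative, i.e. defines a character of the permutation Hopf algebra 𝔖Sym with values in ℚ(x).) -/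
noncomputable section

/-- The field `K = ℚ(x₁, x₂, …)`. -/
abbrev K : Type := FractionRing (MvPolynomial ℕ ℚ)

/-- The variable `xᵢ` (0-indexed), viewed as an element of `K`. -/
def xK (i : ℕ) : K :=
  algebraMap (MvPolynomial ℕ ℚ) K (MvPolynomial.X i)

/-- `chi F N v = χ_N(v₁, …, v_N)`, with 0-indexed arguments `v 0, …, v (N-1)`. -/
def chi (F : Type*) [Field F] (N : ℕ) (v : ℕ → F) : F :=
  (v 0 * (∏ j ∈ Finset.range (N - 1), (v (j + 1) - v j)) * (1 - v (N - 1)))⁻¹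

/-- An `(m,n)`-shuffle (0-indexed). -/
def IsShuffle (m n : ℕ) (τ : Equiv.Perm (Fin (m + n))) : Prop :=
  (∀ i j : Fin (m + n), (i : ℕ) < (j : ℕ) → (j : ℕ) < m → τ i < τ j) ∧
  (∀ i j : Fin (m + n), (i : ℕ) < (j : ℕ) → m ≤ (i : ℕ) → τ i < τ j)

/-- The block map `w : {1,…,m+n} → {1,…,m+n}`, `w(i) = σ(i)` for `i ≤ m` and
`w(i) = m + ρ(i−m)` for `i > m` (0-indexed; the value is returned as the 0-indexed
index of a variable). -/
def wmap (m n : ℕ) (σ : Equiv.Perm (Fin m)) (ρ : Equiv.Perm (Fin n))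
    (i : Fin (m + n)) : ℕ :=
  if h : (i : ℕ) < m then (σ ⟨i, h⟩ : ℕ)
  else m + (ρ ⟨(i : ℕ) - m, by have := i.isLt; omega⟩ : ℕ)

/-- The product `((v₁ - p) (v₂ - v₁) ⋯ (v_N - v_{N-1}) (1 - v_N))⁻¹` along a list, started at `p`. -/
def chainInv {F : Type*} [Field F] : F → List F → F
  | p, [] => (1 - p)⁻¹
  | p, a :: l => (a - p)⁻¹ * chainInv a l

theorem chainInv_map_range {F : Type*} [Field F] (k : ℕ) (p : F) (v : ℕ → F) :
    chainInv p ((List.range (k + 1)).map v) =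
      ((v 0 - p) * (∏ j ∈ Finset.range k, (v (j + 1) - v j)) * (1 - v k))⁻¹ := by
  induction k generalizing p v with
  | zero => simp [chainInv, mul_comm]
  | succ k ih =>
    rw [List.range_succ_eq_map, List.map_cons, List.map_map, chainInv, ih, Finset.prod_range_succ']
    simp only [Function.comp, mul_inv, Nat.succ_eq_add_one, zero_add]
    ring

theorem chi_eq_chainInv {F : Type*} [Field F] {N : ℕ} (hN : 1 ≤ N) (v : ℕ → F) :
    chi F N v = chainInv 0 ((List.range N).map v) := by
  obtain ⟨k, rfl⟩ := Nat.exists_eq_add_of_le' hN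
  rw [chainInv_map_range]
  simp [chi]

theorem map_range_dite {α : Type*} [Zero α] (N : ℕ) (g : Fin N → α) :
    (List.range N).map (fun j => if h : j < N then g ⟨j, h⟩ else 0) = List.ofFn g := by
  apply List.ext_getElem
  · simp
  · intro i h₁ h₂
    have : i < N := by simpa using h₂
    simp [this]

/-- The finite set of interleavings of two lists. -/
def shuffles {α : Type*} [DecidableEq α] : List α → List α → Finset (List α)
  | [], v => {v}
  | a :: u, [] => {a :: u}
  | a :: u, b :: v =>
    (shuffles u (b :: v)).image (List.cons a) ∪ (shuffles (a :: u) v).image (List.cons b)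
termination_by u v => u.length + v.length

theorem sum_shuffles_chainInv {F α : Type*} [Field F] [DecidableEq α] (f : α → F)
    (u v : List α) (p : F) (hp : p ≠ 1) (hf : ∀ a, f a ≠ 1)
    (huv : ∀ a ∈ u, ∀ b ∈ v, f a ≠ f b) (hu : (u.map f).Nodup) (hv : (v.map f).Nodup)
    (hpu : ∀ a ∈ u, f a ≠ p) (hpv : ∀ a ∈ v, f a ≠ p) :
    ∑ l ∈ shuffles u v, chainInv p (l.map f) =
      (1 - p) * chainInv p (u.map f) * chainInv p (v.map f) := by
  have hp1 : 1 - p ≠ 0 := sub_ne_zero.2 hp.symm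
  induction u, v using shuffles.induct generalizing p with
  | case1 v => simp [shuffles, chainInv, hp1]
  | case2 a u => rw [shuffles]; simp [chainInv]; field_simp
  | case3 a u b v ih₁ ih₂ =>
    have hab : f a ≠ f b := huv a (by simp) b (by simp)
    have hap : f a - p ≠ 0 := sub_ne_zero.2 (hpu a (by simp))
    have hbp : f b - p ≠ 0 := sub_ne_zero.2 (hpv b (by simp))
    have hab' : f a - f b ≠ 0 := sub_ne_zero.2 hab
    have hba' : f b - f a ≠ 0 := sub_ne_zero.2 hab.symm
    have hdisj : Disjoint ((shuffles u (b :: v)).image (List.cons a))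
        ((shuffles (a :: u) v).image (List.cons b)) := by
      rw [Finset.disjoint_left]
      intro l h₁ h₂
      obtain ⟨l₁, -, rfl⟩ := Finset.mem_image.1 h₁
      obtain ⟨l₂, -, h⟩ := Finset.mem_image.1 h₂
      exact hab (by rw [(List.cons.inj h).1])
    rw [List.map_cons, List.nodup_cons, List.mem_map] at hu hv
    rw [shuffles, Finset.sum_union hdisj, Finset.sum_image (by simp), Finset.sum_image (by simp)]
    simp only [List.map_cons, chainInv, ← Finset.mul_sum]
    rw [ih₁ (f a) (hf a) (fun x hx => huv x (by simp [hx])) hu.2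
        (by simpa using hv) (fun x hx h => hu.1 ⟨x, hx, h⟩)
        (fun x hx => (huv a (by simp) x hx).symm) (sub_ne_zero.2 (hf a).symm),
      ih₂ (f b) (hf b) (fun x hx y hy => huv x hx y (by simp [hy])) (by simpa using hu) hv.2
        (fun x hx => huv x hx b (by simp)) (fun x hx h => hv.1 ⟨x, hx, h⟩)
        (sub_ne_zero.2 (hf b).symm)]
    simp only [List.map_cons, chainInv]
    have key : (f a - p)⁻¹ * (1 - f a) * (f b - f a)⁻¹ + (f b - p)⁻¹ * (1 - f b) * (f a - f b)⁻¹
        = (1 - p) * (f a - p)⁻¹ * (f b - p)⁻¹ := by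
      rw [← neg_sub (f b) (f a), inv_neg]
      field_simp
      ring
    linear_combination chainInv (f a) (u.map f) * chainInv (f b) (v.map f) * key

theorem mem_shuffles_iff {α : Type*} [DecidableEq α] (q : α → Bool) (l u v : List α)
    (hu : ∀ a ∈ u, q a = true) (hv : ∀ a ∈ v, q a = false) :
    l ∈ shuffles u v ↔ l.filter q = u ∧ l.filter (fun a => !q a) = v := by
  induction u, v using shuffles.induct generalizing l with
  | case1 v =>
    rw [shuffles, Finset.mem_singleton]
    constructor
    · rintro rfl
      refine ⟨List.filter_eq_nil_iff.2 (by simpa using hv), List.filter_eq_self.2 (by simpa using hv)⟩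
    · rintro ⟨h₁, rfl⟩
      rw [List.filter_eq_nil_iff] at h₁
      exact (List.filter_eq_self.2 (by simpa using h₁)).symm
  | case2 a u =>
    rw [shuffles, Finset.mem_singleton]
    constructor
    · rintro rfl
      refine ⟨List.filter_eq_self.2 hu, List.filter_eq_nil_iff.2 (by simpa using hu)⟩
    · rintro ⟨h₁, h₂⟩
      rw [← h₁]
      rw [List.filter_eq_nil_iff] at h₂
      exact (List.filter_eq_self.2 (by simpa using h₂)).symm
  | case3 a u b v ih₁ ih₂ =>
    have ha : q a = true := hu a (by simp)
    have hb : q b = false := hv b (by simp)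
    rw [shuffles, Finset.mem_union, Finset.mem_image, Finset.mem_image]
    cases l with
    | nil => simp
    | cons c l =>
      have h₁ := ih₁ l (fun x hx => hu x (by simp [hx])) hv
      have h₂ := ih₂ l hu (fun x hx => hv x (by simp [hx]))
      cases hc : q c
      · have : a ≠ c := by rintro rfl; simp [ha] at hc
        simp [hc, h₂, this]
        aesop
      · have : b ≠ c := by rintro rfl; simp [hb] at hc
        simp [hc, h₁, this]
        aesop

/-- The first block `0, …, m - 1` of `Fin (m + n)`, in increasing order. -/
def leftBlock (m n : ℕ) : List (Fin (m + n)) := (List.finRange m).map (Fin.castAdd n)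

/-- The second block `m, …, m + n - 1` of `Fin (m + n)`, in increasing order. -/
def rightBlock (m n : ℕ) : List (Fin (m + n)) := (List.finRange n).map (Fin.natAdd m)

theorem mem_leftBlock {m n : ℕ} (i : Fin (m + n)) : i ∈ leftBlock m n ↔ (i : ℕ) < m := by
  simp only [leftBlock, List.mem_map, List.mem_finRange, true_and]
  exact ⟨by rintro ⟨j, rfl⟩; simp, fun h => ⟨⟨i, h⟩, rfl⟩⟩

theorem mem_rightBlock {m n : ℕ} (i : Fin (m + n)) : i ∈ rightBlock m n ↔ m ≤ (i : ℕ) := by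
  simp only [rightBlock, List.mem_map, List.mem_finRange, true_and]
  refine ⟨by rintro ⟨j, rfl⟩; simp, fun h => ⟨⟨i - m, by omega⟩, ?_⟩⟩
  ext
  simp
  omega

theorem pairwise_leftBlock (m n : ℕ) : (leftBlock m n).Pairwise (· < ·) := by
  rw [leftBlock, List.pairwise_map]
  exact (List.pairwise_lt_finRange m).imp fun h => h

theorem pairwise_rightBlock (m n : ℕ) : (rightBlock m n).Pairwise (· < ·) := by
  rw [rightBlock, List.pairwise_map]
  exact (List.pairwise_lt_finRange n).imp fun h =>
    Nat.add_lt_add_left h m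

theorem perm_finRange_of_filter_eq_blocks {m n : ℕ} {l : List (Fin (m + n))}
    (hl : l.filter (fun i : Fin (m + n) => decide ((i : ℕ) < m)) = leftBlock m n ∧
      l.filter (fun i : Fin (m + n) => !decide ((i : ℕ) < m)) = rightBlock m n) :
    l.Perm (List.finRange (m + n)) := by
  have h := (List.filter_append_perm (fun i : Fin (m + n) => decide ((i : ℕ) < m)) l).symm
  rw [hl.1, hl.2] at h
  refine h.trans ((List.perm_ext_iff_of_nodup ?_ (List.nodup_finRange _)).2 ?_)
  · refine List.Nodup.append (pairwise_leftBlock m n).nodup (pairwise_rightBlock m n).nodup ?_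
    intro i h₁ h₂
    rw [mem_leftBlock] at h₁
    rw [mem_rightBlock] at h₂
    omega
  · intro i
    simp only [List.mem_append, mem_leftBlock, mem_rightBlock, List.mem_finRange, iff_true]
    omega

theorem filter_ofFn_eq {N : ℕ} (τ : Equiv.Perm (Fin N)) (q : Fin N → Bool) (u : List (Fin N))
    (hmem : ∀ i, i ∈ u ↔ q i = true) (hu : u.Pairwise (· < ·))
    (hτ : ∀ i j, i < j → q i = true → q j = true → τ i < τ j) :
    (List.ofFn (τ⁻¹ : Equiv.Perm (Fin N))).filter q = u := by
  have hpw : ((List.ofFn (τ⁻¹ : Equiv.Perm (Fin N))).filter q).Pairwise (· < ·) := by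
    rw [List.pairwise_filter, List.pairwise_ofFn]
    intro i j hij hi hj
    by_contra hlt
    rcases (not_lt.1 hlt).lt_or_eq with h | h
    · exact absurd (hτ _ _ h hj hi) (by simpa using hij.le)
    · exact hij.ne' (τ⁻¹.injective h)
  refine List.Perm.eq_of_pairwise (le := (· < ·)) (fun a b _ _ h₁ h₂ => absurd h₁ h₂.asymm) hpw hu ?_
  refine (List.perm_ext_iff_of_nodup hpw.nodup hu.nodup).2 fun i => ?_
  rw [hmem, List.mem_filter, List.mem_ofFn]
  exact ⟨And.right, fun h => ⟨⟨τ i, by simp⟩, h⟩⟩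

theorem lt_of_filter_ofFn_eq {N : ℕ} (τ : Equiv.Perm (Fin N)) (q : Fin N → Bool)
    (u : List (Fin N)) (hu : u.Pairwise (· < ·))
    (h : (List.ofFn (τ⁻¹ : Equiv.Perm (Fin N))).filter q = u)
    (i j : Fin N) (hij : i < j) (hi : q i = true) (hj : q j = true) : τ i < τ j := by
  rw [← h, List.pairwise_filter, List.pairwise_ofFn] at hu
  by_contra hlt
  rcases (not_lt.1 hlt).lt_or_eq with h' | h'
  · have := hu h' (by simpa using hj) (by simpa using hi)
    exact absurd hij (by simpa using this.le)
  · exact hij.ne' (τ.injective h')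

theorem isShuffle_iff_ofFn_mem {m n : ℕ} (τ : Equiv.Perm (Fin (m + n))) :
    IsShuffle m n τ ↔
      List.ofFn (τ⁻¹ : Equiv.Perm (Fin (m + n))) ∈ shuffles (leftBlock m n) (rightBlock m n) := by
  rw [mem_shuffles_iff (fun i : Fin (m + n) => decide ((i : ℕ) < m)) _ _ _
    (by simp [mem_leftBlock]) (by simp [mem_rightBlock])]
  constructor
  · rintro ⟨h₁, h₂⟩
    exact ⟨filter_ofFn_eq τ _ _ (by simp [mem_leftBlock]) (pairwise_leftBlock m n)
        fun i j hij _ hj => h₁ i j hij (by simpa using hj),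
      filter_ofFn_eq τ _ _ (by simp [mem_rightBlock]) (pairwise_rightBlock m n)
        fun i j hij hi _ => h₂ i j hij (by simpa using hi)⟩
  · rintro ⟨h₁, h₂⟩
    refine ⟨fun i j hij hj => ?_, fun i j hij hi => ?_⟩
    · exact lt_of_filter_ofFn_eq τ _ _ (pairwise_leftBlock m n) h₁ i j hij
        (by simp; omega) (by simpa using hj)
    · exact lt_of_filter_ofFn_eq τ _ _ (pairwise_rightBlock m n) h₂ i j
        hij (by simpa using hi) (by simp; omega)

theorem exists_perm_ofFn_eq {N : ℕ} {l : List (Fin N)} (hl : l.Perm (List.finRange N)) :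
    ∃ τ : Equiv.Perm (Fin N), List.ofFn (τ⁻¹ : Equiv.Perm (Fin N)) = l := by
  have hlen : l.length = N := by simpa using hl.length_eq
  have hnd : l.Nodup := hl.nodup_iff.2 (List.nodup_finRange N)
  let g : Fin N → Fin N := fun i => l.get (i.cast hlen.symm)
  have hg : Function.Injective g := fun i j hij => by
    simpa using List.nodup_iff_injective_get.1 hnd hij
  refine ⟨(Equiv.ofBijective g (Finite.injective_iff_bijective.1 hg))⁻¹, ?_⟩
  rw [inv_inv]
  apply List.ext_getElem
  · simp [hlen]
  · intro i h₁ h₂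
    simp [g]

open scoped Classical in
theorem sum_isShuffle {M : Type*} [AddCommMonoid M] (m n : ℕ) (G : List (Fin (m + n)) → M) :
    ∑ τ ∈ Finset.univ.filter (fun τ : Equiv.Perm (Fin (m + n)) => IsShuffle m n τ),
        G (List.ofFn (τ⁻¹ : Equiv.Perm (Fin (m + n)))) =
      ∑ l ∈ shuffles (leftBlock m n) (rightBlock m n), G l := by
  refine Finset.sum_bij (fun τ _ => List.ofFn (τ⁻¹ : Equiv.Perm (Fin (m + n)))) ?_ ?_ ?_ ?_
  · intro τ hτ
    exact (isShuffle_iff_ofFn_mem τ).1 (Finset.mem_filter.1 hτ).2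
  · intro τ₁ _ τ₂ _ h
    exact inv_injective (DFunLike.coe_injective (List.ofFn_injective h))
  · intro l hl
    obtain ⟨τ, rfl⟩ := exists_perm_ofFn_eq (perm_finRange_of_filter_eq_blocks
      ((mem_shuffles_iff (fun i : Fin (m + n) => decide ((i : ℕ) < m)) _ _ _
        (by simp [mem_leftBlock]) (by simp [mem_rightBlock])).1 hl))
    exact ⟨τ, by simpa using (isShuffle_iff_ofFn_mem τ).2 hl, rfl⟩
  · intro τ _
    rfl

theorem xK_injective : Function.Injective xK :=
  (IsFractionRing.injective (MvPolynomial ℕ ℚ) K).comp MvPolynomial.X_injective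

theorem xK_ne_zero (i : ℕ) : xK i ≠ 0 := by
  rw [xK, Ne, IsFractionRing.to_map_eq_zero_iff]
  exact MvPolynomial.X_ne_zero i

theorem xK_ne_one (i : ℕ) : xK i ≠ 1 := by
  intro h
  rw [xK, ← map_one (algebraMap (MvPolynomial ℕ ℚ) K)] at h
  have := congrArg (MvPolynomial.eval 0) (IsFractionRing.injective (MvPolynomial ℕ ℚ) K h)
  simp at this

theorem wmap_castAdd {m n : ℕ} (σ : Equiv.Perm (Fin m)) (ρ : Equiv.Perm (Fin n)) (i : Fin m) :
    wmap m n σ ρ (Fin.castAdd n i) = σ i := by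
  simp [wmap]

theorem wmap_natAdd {m n : ℕ} (σ : Equiv.Perm (Fin m)) (ρ : Equiv.Perm (Fin n)) (i : Fin n) :
    wmap m n σ ρ (Fin.natAdd m i) = m + ρ i := by
  simp [wmap]

theorem wmap_injective {m n : ℕ} (σ : Equiv.Perm (Fin m)) (ρ : Equiv.Perm (Fin n)) :
    Function.Injective (wmap m n σ ρ) := by
  intro i j
  induction i using Fin.addCases <;> induction j using Fin.addCases <;>
    simp only [wmap_castAdd, wmap_natAdd] <;> intro h
  · rw [σ.injective (Fin.ext h)]
  · omega
  · omega
  · rw [ρ.injective (Fin.ext (Nat.add_left_cancel h))]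

open scoped Classical in
/-- Multiplicativity of the character `𝔽_σ ↦ χ_m(x_{σ(1)},…,x_{σ(m)})` of the
permutation Hopf algebra `𝔖Sym`: for all `m, n ≥ 1`, `σ ∈ S_m`, `ρ ∈ S_n`,
`Σ_{τ ∈ Sh(m,n)} χ_{m+n}(x_{w(τ⁻¹(1))}, …, x_{w(τ⁻¹(m+n))})
  = χ_m(x_{σ(1)}, …, x_{σ(m)}) · χ_n(x_{m+ρ(1)}, …, x_{m+ρ(n)})`. -/
theorem chi_character_multiplicative (m n : ℕ) (hm : 1 ≤ m) (hn : 1 ≤ n)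
    (σ : Equiv.Perm (Fin m)) (ρ : Equiv.Perm (Fin n)) :
    ∑ τ ∈ Finset.univ.filter (fun τ : Equiv.Perm (Fin (m + n)) => IsShuffle m n τ),
        chi K (m + n)
          (fun j => if h : j < m + n then xK (wmap m n σ ρ (τ⁻¹ ⟨j, h⟩)) else 0)
      = chi K m (fun j => if h : j < m then xK ((σ ⟨j, h⟩ : Fin m) : ℕ) else 0)
        * chi K n (fun j => if h : j < n then xK (m + ((ρ ⟨j, h⟩ : Fin n) : ℕ)) else 0) := by
  have hinj : Function.Injective (fun i => xK (wmap m n σ ρ i)) :=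
    xK_injective.comp (wmap_injective σ ρ)
  have hblocks := sum_shuffles_chainInv (fun i => xK (wmap m n σ ρ i)) (leftBlock m n)
    (rightBlock m n) 0 zero_ne_one (fun _ => xK_ne_one _)
    (fun a ha b hb h => by
      have hab := hinj h
      rw [mem_leftBlock] at ha
      rw [mem_rightBlock] at hb
      omega)
    ((pairwise_leftBlock m n).nodup.map hinj) ((pairwise_rightBlock m n).nodup.map hinj)
    (fun _ _ => xK_ne_zero _) (fun _ _ => xK_ne_zero _)
  rw [← sum_isShuffle m n] at hblocks
  rw [chi_eq_chainInv hm, chi_eq_chainInv hn, map_range_dite m fun j => xK (σ j),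
    map_range_dite n fun j => xK (m + ρ j)]
  simp only [leftBlock, rightBlock, ← List.ofFn_eq_map, List.map_ofFn, Function.comp_def,
    wmap_castAdd, wmap_natAdd, sub_zero, one_mul] at hblocks
  rw [← hblocks]
  refine Finset.sum_congr rfl fun τ _ => ?_
  rw [chi_eq_chainInv (by omega), map_range_dite (m + n) fun j => xK (wmap m n σ ρ (τ⁻¹ j))]
end
end

section
/- For any scalars c₀, c₁, …, c_N ∈ R, Σ_{r=0}^{N} (−1)^r c_r · (ω₀·ω₁⋯ω̂_r⋯ω_N) = (−1)^N·(Σ_{r=0}^{N} c_r)·ι(e₁)·ι(e₂)⋯ι(e_N) in Λ(R^N), where in each summand the factor ω_r is omitted and the remaining factors are multiplied in increasing order of j. (Applied with c_r = t_{r+1} − t_r, t₀ = 0, t_{N+1} = 1, this is the identity ϝ_N^*(θ_N) = (−1)^N χ_N(t₁,…,t_N) dt₁∧⋯∧dt_N used in the proof that ψ_{m,n#}(Θ_{m+n}) = Θ_m × Θ_n, i.e. that the polar element satisfies Ψ¹(Θ) = Θ ⊠ Θ.) -/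
/-- The vectors `e₀, e₁, …, e_N, e_{N+1}` in `R^N`: `e_j` is the `j`-th standard
basis vector for `1 ≤ j ≤ N`, and `e₀ = e_{N+1} = 0`. -/
def stdE (R : Type*) [CommRing R] (N : ℕ) (j : ℕ) : Fin N → R :=
  if h : 1 ≤ j ∧ j ≤ N then Pi.single (⟨j - 1, by omega⟩ : Fin N) 1 else 0

/-- `ω_j = ι(e_{j+1}) − ι(e_j)` in the exterior algebra `Λ(R^N)`, `0 ≤ j ≤ N`. -/
def omegaE (R : Type*) [CommRing R] (N : ℕ) (j : ℕ) :
    ExteriorAlgebra R (Fin N → R) :=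
  ExteriorAlgebra.ι R (stdE R N (j + 1)) - ExteriorAlgebra.ι R (stdE R N j)

theorem prod_range_map_succ_sub {A : Type*} [Ring A] {f : ℕ → A} (hf : ∀ i, f i * f i = 0)
    (h0 : f 0 = 0) (r : ℕ) :
    ((List.range r).map fun j => f (j + 1) - f j).prod =
      ((List.range r).map fun j => f (j + 1)).prod := by
  induction r with
  | zero => simp
  | succ r ih =>
    have key : ((List.range r).map fun j => f (j + 1)).prod * f r = 0 := by
      cases r with
      | zero => simp [h0]
      | succ r => simp [List.range_succ, mul_assoc, hf]
    simp only [List.range_succ, List.map_append, List.prod_append, ih, List.map_cons,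
      List.map_nil, List.prod_singleton, mul_sub, key, sub_zero]

theorem prod_range'_map_succ_sub {A : Type*} [Ring A] {f : ℕ → A} (hf : ∀ i, f i * f i = 0)
    (s m : ℕ) (hm : f (s + m) = 0) :
    ((List.range' s m).map fun j => f (j + 1) - f j).prod =
      (-1) ^ m * ((List.range' s m).map f).prod := by
  induction m generalizing s with
  | zero => simp
  | succ m ih =>
    have key : f (s + 1) * ((List.range' (s + 1) m).map f).prod = 0 := by
      cases m with
      | zero => simpa using hm
      | succ m => simp [List.range'_succ, ← mul_assoc, hf]
    have hc (x : A) : x * (-1) ^ m = (-1) ^ m * x :=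
      ((Commute.neg_one_right x).pow_right m).eq
    simp only [List.range'_succ, List.map_cons, List.prod_cons]
    rw [ih (s + 1) (by rwa [add_right_comm, add_assoc]), ← mul_assoc, hc, mul_assoc, sub_mul, key,
      pow_succ]
    simp

theorem List.filter_ne_range_add_succ (r m : ℕ) :
    (List.range (r + m + 1)).filter (fun j => decide (j ≠ r)) =
      List.range r ++ List.range' (r + 1) m := by
  have h : List.range (r + m + 1) = List.range r ++ r :: List.range' (r + 1) m := by
    rw [← List.range'_succ, List.range_eq_range', List.range_eq_range', add_assoc]
    simpa using (List.range'_append_1 (s := 0) (m := r) (n := m + 1)).symm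
  have h1 : (List.range r).filter (fun j => decide (j ≠ r)) = List.range r := by
    rw [List.filter_eq_self]
    intro j hj
    have := List.mem_range.1 hj
    simp; omega
  have h2 : (List.range' (r + 1) m).filter (fun j => decide (j ≠ r)) =
      List.range' (r + 1) m := by
    rw [List.filter_eq_self]
    intro j hj
    have := List.mem_range'_1.1 hj
    simp; omega
  rw [h, List.filter_append, List.filter_cons, h1, h2]
  simp

theorem prod_filter_ne_map_succ_sub {A : Type*} [Ring A] {f : ℕ → A}
    (hf : ∀ i, f i * f i = 0) (h0 : f 0 = 0) (r m : ℕ) (hm : f (r + m + 1) = 0) :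
    (((List.range (r + m + 1)).filter (fun j => decide (j ≠ r))).map
        fun j => f (j + 1) - f j).prod =
      (-1) ^ m * ((List.range (r + m)).map fun j => f (j + 1)).prod := by
  have hs : ((List.range (r + m)).map fun j => f (j + 1)).prod =
      ((List.range r).map fun j => f (j + 1)).prod * ((List.range' (r + 1) m).map f).prod := by
    rw [List.range_add, List.map_append, List.prod_append, List.range'_eq_map_range,
      List.map_map, List.map_map]
    simp only [Function.comp_def, add_right_comm]
  rw [List.filter_ne_range_add_succ, List.map_append, List.prod_append,
    prod_range_map_succ_sub hf h0,
    prod_range'_map_succ_sub hf _ _ (by rwa [add_right_comm]), hs, ← mul_assoc, ← mul_assoc,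
    ((Commute.neg_one_right _).pow_right m).eq]

/-- For any scalars `c₀, …, c_N ∈ R`,
`Σ_{r=0}^{N} (−1)^r c_r · (ω₀ ω₁ ⋯ ω̂_r ⋯ ω_N) = (−1)^N (Σ_{r=0}^N c_r) · ι(e₁) ⋯ ι(e_N)`
in `Λ(R^N)` (in each summand the factor `ω_r` is omitted and the remaining factors
are multiplied in increasing order of `j`). -/
theorem omega_alternating_sum (R : Type*) [CommRing R] (N : ℕ) (c : ℕ → R) :
    ∑ r ∈ Finset.range (N + 1),
        ((-1 : R) ^ r * c r) •
          (((List.range (N + 1)).filter (fun j => decide (j ≠ r))).map (omegaE R N)).prod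
      = ((-1 : R) ^ N * ∑ r ∈ Finset.range (N + 1), c r) •
          (((List.range N).map (fun j => ExteriorAlgebra.ι R (stdE R N (j + 1)))).prod) := by
  rw [Finset.mul_sum, Finset.sum_smul]
  refine Finset.sum_congr rfl fun r hr => ?_
  obtain ⟨m, rfl⟩ := Nat.exists_eq_add_of_le (Nat.lt_succ_iff.1 (Finset.mem_range.1 hr))
  have h := prod_filter_ne_map_succ_sub
    (f := fun j => ExteriorAlgebra.ι R (stdE R (r + m) j))
    (fun _ => ExteriorAlgebra.ι_sq_zero _) (by simp [stdE]) r m (by simp [stdE])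
  have hsign (x : ExteriorAlgebra R (Fin (r + m) → R)) : (-1) ^ m * x = (-1 : R) ^ m • x := by
    rw [Algebra.smul_def]; simp
  change _ • (List.map (fun j => _ - _) _).prod = _
  rw [h, hsign, smul_smul, pow_add, mul_right_comm]
end

section
/- One has δ̂_{p+1} ∘ δ̂_p = 0 for all p ≥ 0, the range of δ̂_{p−1} equals the kernel of δ̂_p for every p ≥ 1, and δ̂₀ = 0. Consequently the cochain complex (V_•, δ̂) has cohomology isomorphic to ℂ in degree 0 and cohomology 0 in every degree p ≥ 1. (This is the E₁-page computation proving that 𝒩*_Π(2|∞) is quasi-isomorphic to ℂ concentrated in degree 0.) -/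
noncomputable section

open Polynomial

/-- `τ(m) = 1` if `m` is odd, `0` if `m` is even (as a complex scalar). -/
def tauC (m : ℕ) : ℂ := if Odd m then 1 else 0

/-- The `E₁`-differential `δ̂_p`: the `ℂ`-linear map on polynomials defined on
monomials by `δ̂_p(x^a) = (−1)^p τ(a) x^{a+1} + (−1)^{p−a} τ(p−a) x^a`. -/
def delHat (p : ℕ) : Polynomial ℂ →ₗ[ℂ] Polynomial ℂ :=
  (Polynomial.basisMonomials ℂ).constr ℂ fun a =>
    ((-1 : ℂ) ^ p * tauC a) • (X : Polynomial ℂ) ^ (a + 1)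
      + ((-1 : ℂ) ^ (p - a) * tauC (p - a)) • (X : Polynomial ℂ) ^ a

/-- Induction principle for `degreeLE`: a submodule containing all `X ^ a` with `a ≤ p` contains
every polynomial of degree at most `p`. -/
theorem degreeLE_le_of_X_pow_mem {p : ℕ} {S : Submodule ℂ ℂ[X]}
    (h : ∀ a ≤ p, (X : ℂ[X]) ^ a ∈ S) : degreeLE ℂ (p : WithBot ℕ) ≤ S := by
  classical
  rw [degreeLE_eq_span_X_pow, Submodule.span_le]
  intro f hf
  simp only [Finset.coe_image, Finset.coe_range, Set.mem_image, Set.mem_Iio] at hf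
  obtain ⟨a, ha, rfl⟩ := hf
  exact h a (by omega)

theorem X_pow_mem_degreeLE {a p : ℕ} (h : a ≤ p) :
    (X : ℂ[X]) ^ a ∈ degreeLE ℂ (p : WithBot ℕ) := by
  rw [mem_degreeLE, degree_X_pow]
  exact_mod_cast h

theorem basisMonomials_constr_X_pow (g : ℕ → ℂ[X]) (a : ℕ) :
    (basisMonomials ℂ).constr ℂ g (X ^ a) = g a := by
  have h := (basisMonomials ℂ).constr_basis ℂ g a
  simpa only [coe_basisMonomials, monomial_one_right_eq_X_pow] using h

theorem delHat_X_pow (p a : ℕ) :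
    delHat p (X ^ a) = ((-1 : ℂ) ^ p * tauC a) • (X : ℂ[X]) ^ (a + 1)
      + ((-1 : ℂ) ^ (p - a) * tauC (p - a)) • (X : ℂ[X]) ^ a :=
  basisMonomials_constr_X_pow _ a

theorem delHat_odd_X_pow_even {p a : ℕ} (hp : Odd p) (ha : Even a) (hap : a ≤ p) :
    delHat p (X ^ a) = -X ^ a := by
  have h : Odd (p - a) := Nat.Odd.sub_even hap hp ha
  simp [delHat_X_pow, tauC, h, h.neg_one_pow, Nat.not_odd_iff_even.mpr ha]

theorem delHat_odd_X_pow_odd {p a : ℕ} (hp : Odd p) (ha : Odd a) :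
    delHat p (X ^ a) = -X ^ (a + 1) := by
  have h : ¬ Odd (p - a) := Nat.not_odd_iff_even.mpr (Nat.Odd.sub_odd hp ha)
  simp [delHat_X_pow, tauC, h, hp.neg_one_pow, ha]

theorem delHat_even_X_pow_even {p a : ℕ} (hp : Even p) (ha : Even a) :
    delHat p (X ^ a) = 0 := by
  have h : ¬ Odd (p - a) := Nat.not_odd_iff_even.mpr (hp.tsub ha)
  simp [delHat_X_pow, tauC, h, Nat.not_odd_iff_even.mpr ha]

theorem delHat_even_X_pow_odd {p a : ℕ} (hp : Even p) (ha : Odd a) (hap : a ≤ p) :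
    delHat p (X ^ a) = X ^ (a + 1) - X ^ a := by
  have h : Odd (p - a) := Nat.Even.sub_odd hap hp ha
  simp [delHat_X_pow, tauC, h, h.neg_one_pow, hp.neg_one_pow, ha, sub_eq_add_neg]

theorem degreeLE_le_comap_delHat (p : ℕ) :
    degreeLE ℂ (p : WithBot ℕ) ≤ (degreeLE ℂ ((p + 1 : ℕ) : WithBot ℕ)).comap (delHat p) := by
  refine degreeLE_le_of_X_pow_mem fun a ha => ?_
  rw [Submodule.mem_comap, delHat_X_pow]
  exact add_mem (Submodule.smul_mem _ _ (X_pow_mem_degreeLE (by omega)))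
    (Submodule.smul_mem _ _ (X_pow_mem_degreeLE (by omega)))

theorem delHat_succ_delHat (p : ℕ) {f : ℂ[X]} (hf : f ∈ degreeLE ℂ (p : WithBot ℕ)) :
    delHat (p + 1) (delHat p f) = 0 := by
  suffices h : degreeLE ℂ (p : WithBot ℕ) ≤ LinearMap.ker (delHat (p + 1) ∘ₗ delHat p) from h hf
  refine degreeLE_le_of_X_pow_mem fun a ha => ?_
  rw [LinearMap.mem_ker, LinearMap.comp_apply]
  rcases Nat.even_or_odd p with hp | hp <;> rcases Nat.even_or_odd a with ha' | ha'
  · rw [delHat_even_X_pow_even hp ha', map_zero]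
  · rw [delHat_even_X_pow_odd hp ha' ha, map_sub,
      delHat_odd_X_pow_even hp.add_one ha'.add_one (by omega),
      delHat_odd_X_pow_odd hp.add_one ha', sub_self]
  · rw [delHat_odd_X_pow_even hp ha' ha, map_neg, delHat_even_X_pow_even hp.add_one ha', neg_zero]
  · rw [delHat_odd_X_pow_odd hp ha', map_neg,
      delHat_even_X_pow_even hp.add_one ha'.add_one, neg_zero]

/-- A contracting homotopy for `delHat` in positive degrees. It sends `x^a` to
`(-1)^(p+1) x^(a-1)` for `a ≥ 2` even, to `0` for `a` odd, and `1` to `-1` or `0` according to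
whether `p` is even or odd. -/
def delHatHomotopy (p : ℕ) : ℂ[X] →ₗ[ℂ] ℂ[X] :=
  (basisMonomials ℂ).constr ℂ fun a =>
    if Odd a ∨ (a = 0 ∧ Odd p) then 0 else (-1 : ℂ) ^ (p + 1) • X ^ (a - 1)

theorem delHatHomotopy_X_pow (p a : ℕ) :
    delHatHomotopy p (X ^ a) =
      if Odd a ∨ (a = 0 ∧ Odd p) then 0 else (-1 : ℂ) ^ (p + 1) • X ^ (a - 1) :=
  basisMonomials_constr_X_pow _ a

theorem delHatHomotopy_X_pow_odd (p : ℕ) {a : ℕ} (ha : Odd a) :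
    delHatHomotopy p (X ^ a) = 0 := by
  simp [delHatHomotopy_X_pow, ha]

theorem delHatHomotopy_even_X_pow_even {p a : ℕ} (hp : Even p) (ha : Even a) :
    delHatHomotopy p (X ^ a) = -X ^ (a - 1) := by
  simp [delHatHomotopy_X_pow, Nat.not_odd_iff_even.mpr ha, Nat.not_odd_iff_even.mpr hp,
    hp.add_one.neg_one_pow]

theorem delHatHomotopy_odd_X_pow_even {p a : ℕ} (hp : Odd p) (ha : Even a) (h0 : a ≠ 0) :
    delHatHomotopy p (X ^ a) = X ^ (a - 1) := by
  simp [delHatHomotopy_X_pow, Nat.not_odd_iff_even.mpr ha, h0, hp.add_one.neg_one_pow]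

theorem delHatHomotopy_odd_X_pow_zero {p : ℕ} (hp : Odd p) : delHatHomotopy p (X ^ 0) = 0 := by
  rw [delHatHomotopy_X_pow, if_pos (Or.inr ⟨rfl, hp⟩)]

theorem degreeLE_le_comap_delHatHomotopy (p : ℕ) :
    degreeLE ℂ ((p + 1 : ℕ) : WithBot ℕ) ≤
      (degreeLE ℂ (p : WithBot ℕ)).comap (delHatHomotopy (p + 1)) := by
  refine degreeLE_le_of_X_pow_mem fun a ha => ?_
  rw [Submodule.mem_comap, delHatHomotopy_X_pow]
  split_ifs
  · exact zero_mem _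
  · exact Submodule.smul_mem _ _ (X_pow_mem_degreeLE (by omega))

theorem delHat_homotopy_identity (p : ℕ) {f : ℂ[X]}
    (hf : f ∈ degreeLE ℂ ((p + 1 : ℕ) : WithBot ℕ)) :
    delHat p (delHatHomotopy (p + 1) f) + delHatHomotopy (p + 2) (delHat (p + 1) f) = f := by
  suffices h : degreeLE ℂ ((p + 1 : ℕ) : WithBot ℕ) ≤
      LinearMap.eqLocus (delHat p ∘ₗ delHatHomotopy (p + 1) +
        delHatHomotopy (p + 2) ∘ₗ delHat (p + 1)) LinearMap.id from h hf
  refine degreeLE_le_of_X_pow_mem fun a ha => ?_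
  simp only [LinearMap.mem_eqLocus, LinearMap.add_apply, LinearMap.comp_apply, LinearMap.id_apply]
  rcases Nat.even_or_odd p with hp | hp <;> rcases Nat.even_or_odd a with ha' | ha'
  · rw [delHat_odd_X_pow_even hp.add_one ha' ha, map_neg,
      delHatHomotopy_even_X_pow_even (hp.add even_two) ha']
    rcases a with - | a
    · simp only [delHatHomotopy_odd_X_pow_zero hp.add_one, map_zero, zero_add, neg_neg,
        Nat.zero_sub]
    · have hodd : Odd a := by grind
      rw [delHatHomotopy_odd_X_pow_even hp.add_one ha' (by omega), Nat.add_sub_cancel,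
        delHat_even_X_pow_odd hp hodd (by grind)]
      ring
  · rw [delHatHomotopy_X_pow_odd _ ha', delHat_odd_X_pow_odd hp.add_one ha', map_neg,
      delHatHomotopy_even_X_pow_even (hp.add even_two) ha'.add_one]
    simp
  · rw [delHat_even_X_pow_even hp.add_one ha', delHatHomotopy_even_X_pow_even hp.add_one ha',
      map_neg, map_zero, add_zero]
    rcases a with - | a
    · rw [Nat.zero_sub, delHat_odd_X_pow_even hp ha' (Nat.zero_le p), neg_neg]
    · rw [Nat.add_sub_cancel, delHat_odd_X_pow_odd hp (by grind), neg_neg]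
  · rw [delHatHomotopy_X_pow_odd _ ha', delHat_even_X_pow_odd hp.add_one ha' ha, map_sub,
      delHatHomotopy_X_pow_odd _ ha',
      delHatHomotopy_odd_X_pow_even (hp.add_even even_two) ha'.add_one (by omega)]
    simp

theorem map_delHat_degreeLE (p : ℕ) :
    (degreeLE ℂ (p : WithBot ℕ)).map (delHat p) =
      degreeLE ℂ ((p + 1 : ℕ) : WithBot ℕ) ⊓ LinearMap.ker (delHat (p + 1)) := by
  apply le_antisymm
  · rintro _ ⟨f, hf, rfl⟩
    exact ⟨degreeLE_le_comap_delHat p hf, delHat_succ_delHat p hf⟩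
  · rintro f ⟨hf, hker⟩
    refine ⟨delHatHomotopy (p + 1) f, degreeLE_le_comap_delHatHomotopy p hf, ?_⟩
    have h := delHat_homotopy_identity p hf
    rwa [LinearMap.mem_ker.mp hker, map_zero, add_zero] at h

theorem degreeLE_zero_le_ker_delHat :
    degreeLE ℂ ((0 : ℕ) : WithBot ℕ) ≤ LinearMap.ker (delHat 0) := by
  refine degreeLE_le_of_X_pow_mem fun a ha => ?_
  obtain rfl : a = 0 := by omega
  exact delHat_even_X_pow_even Even.zero Even.zero

/-- Polynomials of degree at most `0` are the constants. -/
def degreeLEZeroEquiv : degreeLE ℂ ((0 : ℕ) : WithBot ℕ) ≃ₗ[ℂ] ℂ :=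
  LinearEquiv.ofBijective (lcoeff ℂ 0 ∘ₗ (degreeLE ℂ ((0 : ℕ) : WithBot ℕ)).subtype) <| by
    constructor
    · rintro ⟨f, hf⟩ ⟨g, hg⟩ h
      rw [mem_degreeLE] at hf hg
      replace h : f.coeff 0 = g.coeff 0 := h
      rw [Subtype.mk.injEq, eq_C_of_degree_le_zero hf, eq_C_of_degree_le_zero hg, h]
    · exact fun c => ⟨⟨C c, mem_degreeLE.mpr degree_C_le⟩, coeff_C_zero⟩

/-- `δ̂_{p+1} ∘ δ̂_p = 0` on `V_p` for all `p ≥ 0`; for `p ≥ 1` the range of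
`δ̂_{p−1} : V_{p−1} → V_p` equals the kernel of `δ̂_p : V_p → V_{p+1}`; and `δ̂₀ = 0`.
Consequently the cochain complex `(V_•, δ̂)` has cohomology `ℂ` in degree `0`
(the kernel of `δ̂₀`, which is all of `V₀`, is linearly isomorphic to `ℂ`) and
cohomology `0` in every degree `p ≥ 1`. -/
theorem delHat_complex_cohomology :
    (∀ p : ℕ, ∀ f ∈ Polynomial.degreeLE ℂ ((p : ℕ) : WithBot ℕ),
        delHat (p + 1) (delHat p f) = 0)
    ∧ (∀ p : ℕ, 1 ≤ p →
        Submodule.map (delHat (p - 1)) (Polynomial.degreeLE ℂ ((p - 1 : ℕ) : WithBot ℕ))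
          = Polynomial.degreeLE ℂ ((p : ℕ) : WithBot ℕ) ⊓ LinearMap.ker (delHat p))
    ∧ (∀ f ∈ Polynomial.degreeLE ℂ ((0 : ℕ) : WithBot ℕ), delHat 0 f = 0)
    ∧ Nonempty
        ((↥(Polynomial.degreeLE ℂ ((0 : ℕ) : WithBot ℕ) ⊓ LinearMap.ker (delHat 0)))
          ≃ₗ[ℂ] ℂ) := by
  refine ⟨fun p f hf => delHat_succ_delHat p hf, fun p hp => ?_,
    fun f hf => degreeLE_zero_le_ker_delHat hf, ?_⟩
  · obtain ⟨q, rfl⟩ := Nat.exists_eq_add_of_le' hp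
    exact map_delHat_degreeLE q
  · rw [inf_eq_left.mpr degreeLE_zero_le_ker_delHat]
    exact ⟨degreeLEZeroEquiv⟩
end
end
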